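/- arXiv:2301.02087 — 4 statements merged into one kernel-verified Lean document; each statement's English description precedes it below -/
import Mathlib

section
/- Let δt > 0, let V > 0 (the measure |D_σ| of a dual cell), let E be a finite index set (the dual faces of the cell), and let ρⁿ, ρⁿ⁺¹, uⁿ, uⁿ⁺¹ be real numbers and (F_ε)_{ε∈E}, (u_ε)_{ε∈E} families of real numbers. Assume the discrete dual mass balance (V/δt)(ρⁿ⁺¹ − ρⁿ) + ∑_{ε∈E} F_ε = 0. Define the discrete convection operator C = (1/δt)(ρⁿ⁺¹ uⁿ⁺¹ − ρⁿ uⁿ) + (1/V) ∑_{ε∈E} F_ε u_ε. Then V · uⁿ⁺¹ · C = (V/(2δt)) (ρⁿ⁺¹ (uⁿ⁺¹)² − ρⁿ (uⁿ)²) + (1/2) ∑_{ε∈E} F_ε (u_ε)² + ∑_{ε∈E} T_ε + R, where T_ε = −(1/2) F_ε (u_ε − uⁿ)² and R = (V/(2δt)) ρⁿ⁺¹ (uⁿ⁺¹ − uⁿ)² + (uⁿ⁺¹ − uⁿ) ∑_{ε∈E} F_ε (u_ε − uⁿ). -/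
/-- Discrete kinetic-energy identity on a single dual cell: if the discrete dual mass balance
`(V/δt)(ρⁿ⁺¹ − ρⁿ) + ∑_ε F_ε = 0` holds, then the discrete convection operator
`C = (1/δt)(ρⁿ⁺¹uⁿ⁺¹ − ρⁿuⁿ) + (1/V)∑_ε F_ε u_ε` satisfies
`V uⁿ⁺¹ C = (V/(2δt))(ρⁿ⁺¹(uⁿ⁺¹)² − ρⁿ(uⁿ)²) + (1/2)∑_ε F_ε u_ε² + ∑_ε T_ε + R`. -/
theorem discrete_kinetic_energy_identity
    {ι : Type*} [Fintype ι] (δt V : ℝ) (hδt : 0 < δt) (hV : 0 < V)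
    (ρn ρn1 un un1 : ℝ) (F uf : ι → ℝ)
    (hmass : V / δt * (ρn1 - ρn) + ∑ ε, F ε = 0) :
    V * un1 * ((ρn1 * un1 - ρn * un) / δt + (1 / V) * ∑ ε, F ε * uf ε)
      = V / (2 * δt) * (ρn1 * un1 ^ 2 - ρn * un ^ 2)
        + (1 / 2) * ∑ ε, F ε * uf ε ^ 2
        + ∑ ε, (-(1 / 2) * F ε * (uf ε - un) ^ 2)
        + (V / (2 * δt) * ρn1 * (un1 - un) ^ 2
            + (un1 - un) * ∑ ε, F ε * (uf ε - un)) := by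
  have hT : ∑ ε, (-(1 / 2) * F ε * (uf ε - un) ^ 2)
      = -(1 / 2) * ∑ ε, F ε * uf ε ^ 2 + un * ∑ ε, F ε * uf ε
        - un ^ 2 / 2 * ∑ ε, F ε := by
    simp only [Finset.mul_sum, ← Finset.sum_add_distrib, ← Finset.sum_sub_distrib]
    exact Finset.sum_congr rfl fun ε _ => by ring
  have hR : ∑ ε, F ε * (uf ε - un) = ∑ ε, F ε * uf ε - un * ∑ ε, F ε := by
    simp only [Finset.mul_sum, ← Finset.sum_sub_distrib]
    exact Finset.sum_congr rfl fun ε _ => by ring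
  have hC (S : ℝ) : V * un1 * ((ρn1 * un1 - ρn * un) / δt + (1 / V) * S)
      = V / δt * un1 * (ρn1 * un1 - ρn * un) + un1 * S := by
    field_simp
  have hhalf : V / (2 * δt) = V / δt / 2 := by ring
  rw [hT, hR, hC, hhalf]
  linear_combination (un * un1 - un ^ 2 / 2) * hmass
end

section
/- Let u_σ, u_σ' ∈ ℝ, let F ∈ ℝ with F ≠ 0, let s = sgn(F), let ξ ∈ ℝ, and let u_ε = (u_σ + u_σ')/2 + (1/2) s (1 − ξ) (u_σ − u_σ'). Define T_σ = −(1/2) F (u_ε − u_σ)² and T_σ' = −(1/2) (−F) (u_ε − u_σ')². Then T_σ + T_σ' = (1/2) (1 − ξ) |F| (u_σ − u_σ')²; in particular, if 0 ≤ ξ ≤ 1 then T_σ + T_σ' ≥ 0. -/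
/-- Net kinetic-energy dissipation of a dual face: with `s = sgn F` and
`u_ε = (u_σ + u_σ')/2 + (1/2)s(1 − ξ)(u_σ − u_σ')`, the remainder terms
`T_σ = −(1/2)F(u_ε − u_σ)²` and `T_σ' = −(1/2)(−F)(u_ε − u_σ')²` satisfy
`T_σ + T_σ' = (1/2)(1 − ξ)|F|(u_σ − u_σ')²`; in particular, if `0 ≤ ξ ≤ 1` then
`T_σ + T_σ' ≥ 0`. -/
theorem face_dissipation_sum (uσ uσ' F ξ s uε Tσ Tσ' : ℝ) (hF : F ≠ 0)
    (hs : (0 < F → s = 1) ∧ (F < 0 → s = -1))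
    (huε : uε = (uσ + uσ') / 2 + (1 / 2) * s * (1 - ξ) * (uσ - uσ'))
    (hTσ : Tσ = -(1 / 2) * F * (uε - uσ) ^ 2)
    (hTσ' : Tσ' = -(1 / 2) * (-F) * (uε - uσ') ^ 2) :
    Tσ + Tσ' = (1 / 2) * (1 - ξ) * |F| * (uσ - uσ') ^ 2
      ∧ (0 ≤ ξ → ξ ≤ 1 → 0 ≤ Tσ + Tσ') := by
  have hsF : s * F = |F| := by
    rcases hF.lt_or_gt with h | h
    · rw [hs.2 h, abs_of_neg h, neg_one_mul]
    · rw [hs.1 h, abs_of_pos h, one_mul]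
  have hsum : Tσ + Tσ' = (1 / 2) * (1 - ξ) * |F| * (uσ - uσ') ^ 2 := by
    rw [← hsF, hTσ, hTσ', huε]
    ring
  refine ⟨hsum, fun _ hξ => ?_⟩
  have hξ' : 0 ≤ 1 - ξ := sub_nonneg.mpr hξ
  rw [hsum]
  positivity
end

section
/- Let u_σ, u_σ' ∈ ℝ, let F ∈ ℝ with F ≠ 0, let s = sgn(F), let ξ ∈ ℝ with 0 ≤ ξ ≤ 2, and let u_ε = (u_σ + u_σ')/2 + (1/2) s (1 − ξ) (u_σ − u_σ'). Define T_σ = −(1/2) F (u_ε − u_σ)² and T_σ' = −(1/2) (−F) (u_ε − u_σ')². Then T_σ + T_σ' ≥ −(1/2) |F| (u_σ − u_σ')². -/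
/-- For the less-limited MUSCL variant with `ξ ∈ [0,2]`: with `s = sgn F` and
`u_ε = (u_σ + u_σ')/2 + (1/2)s(1 − ξ)(u_σ − u_σ')`, the remainder terms
`T_σ = −(1/2)F(u_ε − u_σ)²` and `T_σ' = −(1/2)(−F)(u_ε − u_σ')²` satisfy
`T_σ + T_σ' ≥ −(1/2)|F|(u_σ − u_σ')²`. -/
theorem face_dissipation_lower_bound (uσ uσ' F ξ s uε Tσ Tσ' : ℝ) (hF : F ≠ 0)
    (hs : (0 < F → s = 1) ∧ (F < 0 → s = -1))
    (hξ0 : 0 ≤ ξ) (hξ2 : ξ ≤ 2)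
    (huε : uε = (uσ + uσ') / 2 + (1 / 2) * s * (1 - ξ) * (uσ - uσ'))
    (hTσ : Tσ = -(1 / 2) * F * (uε - uσ) ^ 2)
    (hTσ' : Tσ' = -(1 / 2) * (-F) * (uε - uσ') ^ 2) :
    -(1 / 2) * |F| * (uσ - uσ') ^ 2 ≤ Tσ + Tσ' := by
  have hsF : s * F = |F| := by
    rcases lt_or_gt_of_ne hF with h | h
    · rw [hs.2 h, abs_of_neg h, neg_one_mul]
    · rw [hs.1 h, abs_of_pos h, one_mul]
  have hsum : Tσ + Tσ' = 1 / 2 * |F| * (1 - ξ) * (uσ - uσ') ^ 2 := by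
    rw [← hsF, hTσ, hTσ', huε]
    ring
  have hnonneg : 0 ≤ (2 - ξ) * (|F| * (uσ - uσ') ^ 2) :=
    mul_nonneg (sub_nonneg.2 hξ2) (by positivity)
  rw [hsum]
  linarith
end

section
/- Let δt > 0, V > 0, let E be a finite index set, and let ρⁿ > 0, ρⁿ⁺¹ > 0, u_σ ∈ ℝ, and families (F_ε)_{ε∈E}, (u_ε)_{ε∈E}, (ũ_ε)_{ε∈E}, (α_ε)_{ε∈E} of real numbers with α_ε ∈ [0,1], satisfying: (i) the discrete dual mass balance (V/δt)(ρⁿ⁺¹ − ρⁿ) + ∑_{ε∈E} F_ε = 0; (ii) for each ε ∈ E, u_ε − u_σ = α_ε (u_σ − ũ_ε) if F_ε ≥ 0 and u_ε − u_σ = α_ε (ũ_ε − u_σ) if F_ε < 0; (iii) δt ∑_{ε∈E} (F_ε + α_ε |F_ε|) ≤ ρⁿ V. Then ū = (1/ρⁿ⁺¹) ( ρⁿ u_σ − (δt/V) ∑_{ε∈E} F_ε u_ε ) is a convex combination of u_σ and the values (ũ_ε)_{ε∈E}; in particular, min({u_σ} ∪ {ũ_ε : ε ∈ E}) ≤ ū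 ≤ max({u_σ} ∪ {ũ_ε : ε ∈ E}). -/
/-- Monotonicity (local maximum principle) of the algebraic MUSCL limitation: under the
discrete dual mass balance (i), the structural MUSCL condition (ii) with coefficients
`α_ε ∈ [0,1]`, and the CFL condition (iii), the updated value
`ū = (1/ρⁿ⁺¹)(ρⁿ u_σ − (δt/V)∑_ε F_ε u_ε)` is a convex combination of `u_σ` and the
values `ũ_ε`; in particular it lies between any common lower and upper bounds of these
values. -/
theorem muscl_convex_combination
    {ι : Type*} [Fintype ι] (δt V : ℝ) (hδt : 0 < δt) (hV : 0 < V)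
    (ρn ρn1 uσ : ℝ) (hρn : 0 < ρn) (hρn1 : 0 < ρn1)
    (F uf ut α : ι → ℝ) (hα : ∀ ε, α ε ∈ Set.Icc (0 : ℝ) 1)
    (hmass : V / δt * (ρn1 - ρn) + ∑ ε, F ε = 0)
    (hmuscl : ∀ ε, (0 ≤ F ε → uf ε - uσ = α ε * (uσ - ut ε)) ∧
                   (F ε < 0 → uf ε - uσ = α ε * (ut ε - uσ)))
    (hcfl : δt * ∑ ε, (F ε + α ε * |F ε|) ≤ ρn * V) :
    (∃ (a : ℝ) (b : ι → ℝ), 0 ≤ a ∧ (∀ ε, 0 ≤ b ε) ∧ a + ∑ ε, b ε = 1 ∧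
        (1 / ρn1) * (ρn * uσ - δt / V * ∑ ε, F ε * uf ε) = a * uσ + ∑ ε, b ε * ut ε)
      ∧ ∀ m M : ℝ, m ≤ uσ → uσ ≤ M → (∀ ε, m ≤ ut ε ∧ ut ε ≤ M) →
          m ≤ (1 / ρn1) * (ρn * uσ - δt / V * ∑ ε, F ε * uf ε)
            ∧ (1 / ρn1) * (ρn * uσ - δt / V * ∑ ε, F ε * uf ε) ≤ M := by
  have hflux : ∑ ε, F ε * uf ε
      = (∑ ε, (F ε + α ε * |F ε|)) * uσ - ∑ ε, α ε * |F ε| * ut ε := by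
    rw [Finset.sum_mul, ← Finset.sum_sub_distrib]
    refine Finset.sum_congr rfl fun ε _ => ?_
    rcases le_or_gt 0 (F ε) with h | h
    · rw [abs_of_nonneg h]
      linear_combination F ε * (hmuscl ε).1 h
    · rw [abs_of_neg h]
      linear_combination F ε * (hmuscl ε).2 h
  have hbalance : ρn1 = ρn - δt / V * ∑ ε, F ε := by
    field_simp at hmass ⊢
    linear_combination hmass
  have hconv : ∃ (a : ℝ) (b : ι → ℝ), 0 ≤ a ∧ (∀ ε, 0 ≤ b ε) ∧ a + ∑ ε, b ε = 1 ∧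
      (1 / ρn1) * (ρn * uσ - δt / V * ∑ ε, F ε * uf ε) = a * uσ + ∑ ε, b ε * ut ε := by
    refine ⟨(ρn - δt / V * ∑ ε, (F ε + α ε * |F ε|)) / ρn1,
      fun ε => δt / V / ρn1 * (α ε * |F ε|), ?_, fun ε => ?_, ?_, ?_⟩
    · refine div_nonneg (sub_nonneg.2 ?_) hρn1.le
      rwa [div_mul_eq_mul_div, div_le_iff₀ hV]
    · have := (hα ε).1
      positivity
    · rw [← Finset.mul_sum, Finset.sum_add_distrib, div_mul_eq_mul_div (δt / V), ← add_div,
        div_eq_one_iff_eq hρn1.ne']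
      linear_combination -hbalance
    · simp only [mul_assoc (δt / V / ρn1)]
      rw [← Finset.mul_sum, hflux]
      ring
  refine ⟨hconv, fun m M hm hM hut => ?_⟩
  obtain ⟨a, b, ha, hb, hab, hu⟩ := hconv
  rw [hu]
  constructor
  · calc m = a * m + ∑ ε, b ε * m := by rw [← Finset.sum_mul, ← add_mul, hab, one_mul]
      _ ≤ a * uσ + ∑ ε, b ε * ut ε :=
        add_le_add (mul_le_mul_of_nonneg_left hm ha)
          (Finset.sum_le_sum fun ε _ => mul_le_mul_of_nonneg_left (hut ε).1 (hb ε))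
  · calc a * uσ + ∑ ε, b ε * ut ε ≤ a * M + ∑ ε, b ε * M :=
        add_le_add (mul_le_mul_of_nonneg_left hM ha)
          (Finset.sum_le_sum fun ε _ => mul_le_mul_of_nonneg_left (hut ε).2 (hb ε))
      _ = M := by rw [← Finset.sum_mul, ← add_mul, hab, one_mul]
end
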